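/- Let Γ=(P,L,I) be a rank-2 incidence geometry and let λ ≥ 1, k₁, k₂, l be natural numbers with k₁ + k₂ − λ ≥ l. If Γ is (λ,k₁,k₂,l)-sparse, then there exists an orientation of all edges of the multigraph I_λ(Γ) together with a function peb : P ⊔ L → ℕ such that: (i) peb(p) + outdeg(p) = k₁ for every point p ∈ P and peb(ℓ) + outdeg(ℓ) = k₂ for every line ℓ ∈ L, and (ii) for all nonempty subsets A ⊆ P and B ⊆ L, writing W = A ∪ B, Σ_{v∈W} peb(v) + out(W) ≥ l. -/

import Mathlib

open Finset

variable {α β : Type*} [DecidableEq α] [DecidableEq β]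

/-- The source of the edge `e = ((p, ℓ), j)` of the multigraph `I_λ(Γ)` under the
orientation `σ`: the point `p` if `σ e = true`, and the line `ℓ` otherwise. -/
def src (σ : (α × β) × ℕ → Bool) (e : (α × β) × ℕ) : α ⊕ β :=
  if σ e then Sum.inl e.1.1 else Sum.inr e.1.2

/-- The target of the edge `e = ((p, ℓ), j)` under the orientation `σ`:
the endpoint which is not the source. -/
def tgt (σ : (α × β) × ℕ → Bool) (e : (α × β) × ℕ) : α ⊕ β :=
  if σ e then Sum.inr e.1.2 else Sum.inl e.1.1

/-- The out-degree of a vertex `v`: the number of oriented edges of `D` with source `v`. -/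
def outdeg (D : Finset ((α × β) × ℕ)) (σ : (α × β) × ℕ → Bool) (v : α ⊕ β) : ℕ :=
  (D.filter fun e => src σ e = v).card

/-- `span(W)`: the number of oriented edges of `D` with both source and target in `W`. -/
def spanE (D : Finset ((α × β) × ℕ)) (σ : (α × β) × ℕ → Bool)
    (W : Finset (α ⊕ β)) : ℕ :=
  (D.filter fun e => src σ e ∈ W ∧ tgt σ e ∈ W).card

/-- `out(W)`: the number of oriented edges of `D` with source in `W` and target outside `W`. -/
def outE (D : Finset ((α × β) × ℕ)) (σ : (α × β) × ℕ → Bool)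
    (W : Finset (α ⊕ β)) : ℕ :=
  (D.filter fun e => src σ e ∈ W ∧ tgt σ e ∉ W).card

/-- A rank-2 incidence geometry with incidence set `I` is `(lam, k₁, k₂, l)`-sparse if
every nonempty subset `I'` of `I` satisfies
`lam * |I'| ≤ k₁ * |P(I')| + k₂ * |L(I')| - l`, where `P(I') × L(I')` is the support. -/
def IsSparse (lam k₁ k₂ l : ℕ) (I : Finset (α × β)) : Prop :=
  ∀ I' ⊆ I, I'.Nonempty →
    (lam : ℤ) * I'.card ≤
      (k₁ : ℤ) * (I'.image Prod.fst).card + (k₂ : ℤ) * (I'.image Prod.snd).card - l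

/-- The slots available to an edge: `k₁` slots at its point and `k₂` slots at its line. -/
def slots (k₁ k₂ : ℕ) (e : (α × β) × ℕ) : Finset ((α × ℕ) ⊕ (β × ℕ)) :=
  (({e.1.1} : Finset α) ×ˢ range k₁).disjSum (({e.1.2} : Finset β) ×ˢ range k₂)

/-- Under the sparsity bounds, Hall's theorem assigns distinct slots to all edges. -/
theorem exists_injOn_slots (lam k₁ k₂ : ℕ) (I : Finset (α × β))
    (h : ∀ I' ⊆ I, lam * I'.card ≤
      k₁ * (I'.image Prod.fst).card + k₂ * (I'.image Prod.snd).card) :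
    ∃ g : (α × β) × ℕ → (α × ℕ) ⊕ (β × ℕ),
      Set.InjOn g (I ×ˢ range lam : Finset ((α × β) × ℕ)) ∧
        ∀ e ∈ I ×ˢ range lam, g e ∈ slots k₁ k₂ e := by
  obtain ⟨f, hf, hft⟩ := (Finset.all_card_le_biUnion_card_iff_exists_injective
    (fun e : {e // e ∈ I ×ˢ range lam} => slots k₁ k₂ e.1)).1 (by
      intro s
      set I' : Finset (α × β) := s.image fun e => e.1.1 with hI'
      have hsub : I' ⊆ I := by
        intro x hx
        obtain ⟨e, -, rfl⟩ := Finset.mem_image.1 hx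
        exact (Finset.mem_product.1 e.2).1
      have hs : s.card ≤ (I' ×ˢ range lam).card := by
        refine Finset.card_le_card_of_injOn Subtype.val ?_ Subtype.val_injective.injOn
        intro e he
        exact Finset.mem_product.2
          ⟨Finset.mem_image_of_mem _ he, (Finset.mem_product.1 e.2).2⟩
      have ht : (((I'.image Prod.fst) ×ˢ range k₁).disjSum
          ((I'.image Prod.snd) ×ˢ range k₂)) ⊆ s.biUnion fun e => slots k₁ k₂ e.1 := by
        rintro (⟨a, i⟩ | ⟨b, i⟩) hx
        · simp only [Finset.inl_mem_disjSum, Finset.mem_product, Finset.mem_image, hI'] at hx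
          obtain ⟨⟨_, ⟨e, he, rfl⟩, rfl⟩, hi⟩ := hx
          exact Finset.mem_biUnion.2 ⟨e, he, by simpa [slots] using hi⟩
        · simp only [Finset.inr_mem_disjSum, Finset.mem_product, Finset.mem_image, hI'] at hx
          obtain ⟨⟨_, ⟨e, he, rfl⟩, rfl⟩, hi⟩ := hx
          exact Finset.mem_biUnion.2 ⟨e, he, by simpa [slots] using hi⟩
      have h1 := Finset.card_le_card ht
      have h2 := h I' hsub
      simp only [Finset.card_disjSum, Finset.card_product, Finset.card_range] at h1 hs
      nlinarith)
  refine ⟨fun e => if he : e ∈ I ×ˢ range lam then f ⟨e, he⟩ else Sum.inl (e.1.1, 0), ?_, ?_⟩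
  · intro x hx y hy hxy
    have hx' := Finset.mem_coe.1 hx
    have hy' := Finset.mem_coe.1 hy
    simp only [dif_pos hx', dif_pos hy'] at hxy
    exact congrArg Subtype.val (hf hxy)
  · intro e he
    simp only [dif_pos he]
    exact hft ⟨e, he⟩

/-- Orienting every edge away from the vertex of its slot bounds all out-degrees. -/
theorem exists_outdeg_le (lam k₁ k₂ : ℕ) (I : Finset (α × β))
    (h : ∀ I' ⊆ I, lam * I'.card ≤
      k₁ * (I'.image Prod.fst).card + k₂ * (I'.image Prod.snd).card) :
    ∃ σ : (α × β) × ℕ → Bool,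
      ∀ v : α ⊕ β, outdeg (I ×ˢ range lam) σ v ≤ Sum.elim (fun _ => k₁) (fun _ => k₂) v := by
  obtain ⟨g, hg, hgt⟩ := exists_injOn_slots lam k₁ k₂ I h
  refine ⟨fun e => (g e).isLeft, ?_⟩
  have hinj (v : α ⊕ β) : Set.InjOn g
      ((I ×ˢ range lam).filter fun e => src (fun e => (g e).isLeft) e = v) :=
    hg.mono (Finset.coe_subset.2 (Finset.filter_subset _ _))
  rintro (p | x)
  · have hc := Finset.card_le_card_of_injOn
      (t := (range k₁).image fun i => (Sum.inl (p, i) : (α × ℕ) ⊕ (β × ℕ))) g ?_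
      (hinj (Sum.inl p))
    · exact (hc.trans Finset.card_image_le).trans_eq (Finset.card_range _)
    · intro e he
      obtain ⟨heD, hes⟩ := Finset.mem_filter.1 he
      have hm := hgt e heD
      rcases hge : g e with ⟨a, i⟩ | ⟨b, i⟩ <;> simp_all [slots, src]
  · have hc := Finset.card_le_card_of_injOn
      (t := (range k₂).image fun i => (Sum.inr (x, i) : (α × ℕ) ⊕ (β × ℕ))) g ?_
      (hinj (Sum.inr x))
    · exact (hc.trans Finset.card_image_le).trans_eq (Finset.card_range _)
    · intro e he
      obtain ⟨heD, hes⟩ := Finset.mem_filter.1 he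
      have hm := hgt e heD
      rcases hge : g e with ⟨a, i⟩ | ⟨b, i⟩ <;> simp_all [slots, src]

/-- The out-degrees over `W` count the edges spanned by `W` and those leaving `W`. -/
theorem sum_outdeg_eq (D : Finset ((α × β) × ℕ)) (σ : (α × β) × ℕ → Bool)
    (W : Finset (α ⊕ β)) : ∑ v ∈ W, outdeg D σ v = spanE D σ W + outE D σ W := by
  have h1 : ∑ v ∈ W, outdeg D σ v = (D.filter fun e => src σ e ∈ W).card := by
    rw [Finset.card_eq_sum_card_fiberwise (f := src σ) (t := W)
      (s := D.filter fun e => src σ e ∈ W) (fun e he => (Finset.mem_filter.1 he).2)]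
    refine Finset.sum_congr rfl fun v hv => ?_
    rw [outdeg, Finset.filter_filter]
    congr 1
    refine Finset.filter_congr fun e _ => ⟨fun he => ⟨he ▸ hv, he⟩, fun he => he.2⟩
  rw [h1, ← Finset.card_filter_add_card_filter_not (fun e => tgt σ e ∈ W),
    Finset.filter_filter, Finset.filter_filter, spanE, outE]

/-- Each incidence between `A` and `B` contributes `lam` edges to the span of `A ∪ B`. -/
theorem spanE_eq (lam : ℕ) (I : Finset (α × β)) (σ : (α × β) × ℕ → Bool)
    (A : Finset α) (B : Finset β) :
    spanE (I ×ˢ range lam) σ (A.image Sum.inl ∪ B.image Sum.inr) =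
      lam * (I.filter fun i => i.1 ∈ A ∧ i.2 ∈ B).card := by
  have h : ((I ×ˢ range lam).filter fun e =>
      src σ e ∈ A.image Sum.inl ∪ B.image Sum.inr ∧
        tgt σ e ∈ A.image Sum.inl ∪ B.image Sum.inr) =
      (I.filter fun i => i.1 ∈ A ∧ i.2 ∈ B) ×ˢ range lam := by
    ext e
    by_cases he : σ e <;> simp [src, tgt, he] <;> tauto
  rw [spanE, h, Finset.card_product, Finset.card_range, mul_comm]

/-- If `k₁ + k₂ - λ ≥ l` and `Γ` is `(λ, k₁, k₂, l)`-sparse, then all edges of `I_λ(Γ)`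
can be oriented, with a pebble assignment satisfying the pebble-game invariants. -/
theorem orientation_of_sparse (lam k₁ k₂ l : ℕ) (hlam : 1 ≤ lam)
    (hparams : (l : ℤ) ≤ (k₁ : ℤ) + (k₂ : ℤ) - (lam : ℤ))
    (P : Finset α) (L : Finset β) (I : Finset (α × β)) (hI : I ⊆ P ×ˢ L)
    (hsparse : IsSparse lam k₁ k₂ l I) :
    ∃ (σ : (α × β) × ℕ → Bool) (peb : α ⊕ β → ℕ),
      (∀ p ∈ P, peb (Sum.inl p) + outdeg (I ×ˢ Finset.range lam) σ (Sum.inl p) = k₁) ∧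
      (∀ x ∈ L, peb (Sum.inr x) + outdeg (I ×ˢ Finset.range lam) σ (Sum.inr x) = k₂) ∧
      (∀ A ⊆ P, ∀ B ⊆ L, A.Nonempty → B.Nonempty →
        l ≤ (∑ v ∈ A.image Sum.inl ∪ B.image Sum.inr, peb v)
            + outE (I ×ˢ Finset.range lam) σ (A.image Sum.inl ∪ B.image Sum.inr)) := by
  have hhall : ∀ I' ⊆ I, lam * I'.card ≤
      k₁ * (I'.image Prod.fst).card + k₂ * (I'.image Prod.snd).card := by
    intro I' hI'
    rcases I'.eq_empty_or_nonempty with rfl | hne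
    · simp
    · have := hsparse I' hI' hne
      zify
      linarith [Int.natCast_nonneg l]
  obtain ⟨σ, hσ⟩ := exists_outdeg_le lam k₁ k₂ I hhall
  refine ⟨σ, fun v => Sum.elim (fun _ => k₁) (fun _ => k₂) v - outdeg (I ×ˢ range lam) σ v,
    fun p _ => Nat.sub_add_cancel (hσ (Sum.inl p)),
    fun x _ => Nat.sub_add_cancel (hσ (Sum.inr x)), ?_⟩
  intro A _ B _ hA hB
  set W : Finset (α ⊕ β) := A.image Sum.inl ∪ B.image Sum.inr with hW
  have hcap : ∑ v ∈ W, Sum.elim (fun _ => k₁) (fun _ => k₂) v = A.card * k₁ + B.card * k₂ := by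
    rw [hW, Finset.sum_union, Finset.sum_image Sum.inl_injective.injOn,
      Finset.sum_image Sum.inr_injective.injOn]
    · simp
    · simp [Finset.disjoint_left]
  have hsum : ∑ v ∈ W, (Sum.elim (fun _ => k₁) (fun _ => k₂) v
      - outdeg (I ×ˢ range lam) σ v) + ∑ v ∈ W, outdeg (I ×ˢ range lam) σ v
      = A.card * k₁ + B.card * k₂ := by
    rw [← Finset.sum_add_distrib, ← hcap]
    exact Finset.sum_congr rfl fun v _ => Nat.sub_add_cancel (hσ v)
  rw [sum_outdeg_eq, hW, spanE_eq, ← hW] at hsum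
  set J := I.filter fun i => i.1 ∈ A ∧ i.2 ∈ B with hJ
  have hbound : l + lam * J.card ≤ A.card * k₁ + B.card * k₂ := by
    rcases J.eq_empty_or_nonempty with hJe | hJn
    · have hA1 := Nat.mul_le_mul_right k₁ hA.card_pos
      have hB1 := Nat.mul_le_mul_right k₂ hB.card_pos
      rw [hJe, Finset.card_empty]
      omega
    · have hs := hsparse J (Finset.filter_subset _ _) hJn
      have hJA : (J.image Prod.fst).card ≤ A.card := Finset.card_le_card
        (Finset.image_subset_iff.2 fun i hi => (Finset.mem_filter.1 hi).2.1)
      have hJB : (J.image Prod.snd).card ≤ B.card := Finset.card_le_card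
        (Finset.image_subset_iff.2 fun i hi => (Finset.mem_filter.1 hi).2.2)
      have hA1 := Nat.mul_le_mul_right k₁ hJA
      have hB1 := Nat.mul_le_mul_right k₂ hJB
      zify at hA1 hB1 ⊢
      linarith
  beta_reduce
  omega
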